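/- arXiv:1903.06309 — 2 statements merged into one kernel-verified Lean document; each statement's English description precedes it below -/
import Mathlib

section
/- (Corollary of Lemma 2) If d₂ ≥ d₁ + 2w with d₁, d₂ > 0, and σ₁ maximizes σ ↦ V(σ, d₁) over (0, ∞) while σ₂ maximizes σ ↦ V(σ, d₂) over (0, ∞), then σ₂ > σ₁ + w; in particular, if the distance d increases by at least 2w, the optimal standard deviation increases by more than w. -/
open Real MeasureTheory

/-- Gaussian density with mean 0 and standard deviation `σ`. -/
noncomputable def gauss (σ x : ℝ) : ℝ :=
  (1 / (σ * Real.sqrt (2 * Real.pi))) * Real.exp (-x ^ 2 / (2 * σ ^ 2))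

/-- The value function determined by the Q-function `Q₀` shifted by `d`. -/
noncomputable def V (Q₀ : ℝ → ℝ) (σ d : ℝ) : ℝ := ∫ x, gauss σ x * Q₀ (x - d)

theorem integrable_mul_comp_sub {w : ℝ} {Q₀ : ℝ → ℝ} (hQmeas : Measurable Q₀)
    (hQbdd : ∃ C : ℝ, ∀ x, Q₀ x ≤ C) (hQnonneg : ∀ x, 0 ≤ Q₀ x)
    (hQsupp : ∀ x, x ∉ Set.Icc 0 w → Q₀ x = 0) (d : ℝ) {f : ℝ → ℝ} (hf : Continuous f) :
    Integrable fun x => f x * Q₀ (x - d) := by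
  obtain ⟨C, hC⟩ := hQbdd
  have hQ : IntegrableOn (fun x => Q₀ (x - d)) (Set.Icc d (d + w)) := by
    refine Measure.integrableOn_of_bounded (M := C) (by simp)
      (hQmeas.comp (measurable_id.sub_const d)).aestronglyMeasurable ?_
    filter_upwards with x
    rw [Real.norm_of_nonneg (hQnonneg _)]
    exact hC _
  refine (integrableOn_iff_integrable_of_support_subset (s := Set.Icc d (d + w)) ?_).1
    (hQ.continuousOn_mul hf.continuousOn isCompact_Icc)
  intro x hx
  by_contra h
  refine hx ?_
  have : Q₀ (x - d) = 0 := hQsupp _ fun h' => h ⟨by linarith [h'.1], by linarith [h'.2]⟩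
  simp [this]

theorem continuous_gauss (σ : ℝ) : Continuous (gauss σ) := by
  unfold gauss
  fun_prop

theorem gauss_pos {σ : ℝ} (hσ : 0 < σ) (x : ℝ) : 0 < gauss σ x := by
  unfold gauss
  positivity

/-- Tangent-line bound for the Gaussian density under a rescaling of `σ`. -/
theorem le_gauss_div {σ r : ℝ} (hσ : 0 < σ) (hr : 0 < r) (x : ℝ) :
    r * (gauss σ x + (1 - r ^ 2) / (2 * σ ^ 2) * (gauss σ x * x ^ 2)) ≤ gauss (σ / r) x := by
  have hexp : Real.exp (-x ^ 2 / (2 * (σ / r) ^ 2)) = Real.exp (-x ^ 2 / (2 * σ ^ 2)) *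
      Real.exp ((1 - r ^ 2) / (2 * σ ^ 2) * x ^ 2) := by
    rw [← Real.exp_add]
    congr 1
    field_simp
    ring
  have hg : gauss (σ / r) x =
      r * gauss σ x * Real.exp ((1 - r ^ 2) / (2 * σ ^ 2) * x ^ 2) := by
    unfold gauss
    rw [hexp]
    field_simp
  rw [hg]
  calc _ = r * gauss σ x * ((1 - r ^ 2) / (2 * σ ^ 2) * x ^ 2 + 1) := by ring
    _ ≤ _ := mul_le_mul_of_nonneg_left (Real.add_one_le_exp _)
      (mul_pos hr (gauss_pos hσ x)).le

/-- First-order condition satisfied by a maximizer of `σ ↦ V Q₀ σ d`. -/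
theorem integral_gauss_mul_sq_sub_eq_zero {w : ℝ} {Q₀ : ℝ → ℝ} (hQmeas : Measurable Q₀)
    (hQbdd : ∃ C : ℝ, ∀ x, Q₀ x ≤ C) (hQnonneg : ∀ x, 0 ≤ Q₀ x)
    (hQsupp : ∀ x, x ∉ Set.Icc 0 w → Q₀ x = 0) {d σ : ℝ} (hσ : 0 < σ)
    (hmax : ∀ τ : ℝ, 0 < τ → V Q₀ τ d ≤ V Q₀ σ d) :
    ∫ x, gauss σ x * (x ^ 2 - σ ^ 2) * Q₀ (x - d) = 0 := by
  have hint {f : ℝ → ℝ} (hf : Continuous f) : Integrable fun x => f x * Q₀ (x - d) :=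
    integrable_mul_comp_sub hQmeas hQbdd hQnonneg hQsupp d hf
  have hA := hint (continuous_gauss σ)
  have hB : Integrable fun x => gauss σ x * x ^ 2 * Q₀ (x - d) :=
    hint ((continuous_gauss σ).mul (continuous_pow 2))
  set B := ∫ x, gauss σ x * x ^ 2 * Q₀ (x - d) with hBdef
  have hle (r : ℝ) (hr : 0 < r) :
      r * (V Q₀ σ d + (1 - r ^ 2) / (2 * σ ^ 2) * B) ≤ V Q₀ σ d := by
    refine le_trans ?_ (hmax (σ / r) (div_pos hσ hr))
    rw [V, hBdef, ← integral_const_mul, ← integral_add hA (hB.const_mul _),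
      ← integral_const_mul]
    refine integral_mono ((hA.add (hB.const_mul _)).const_mul r)
      (hint (continuous_gauss (σ / r))) fun x => ?_
    calc _ = r * (gauss σ x + (1 - r ^ 2) / (2 * σ ^ 2) * (gauss σ x * x ^ 2)) *
          Q₀ (x - d) := by ring
      _ ≤ _ := mul_le_mul_of_nonneg_right (le_gauss_div hσ hr x) (hQnonneg _)
  have hlocal : IsLocalMax
      (fun r : ℝ => r * (V Q₀ σ d + (1 - r ^ 2) / (2 * σ ^ 2) * B)) 1 := by
    filter_upwards [lt_mem_nhds one_pos] with r hr
    simpa using hle r hr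
  have hderiv : HasDerivAt (fun r : ℝ => r * (V Q₀ σ d + (1 - r ^ 2) / (2 * σ ^ 2) * B))
      (V Q₀ σ d - B / σ ^ 2) 1 := by
    have h := (hasDerivAt_id (1 : ℝ)).mul (((((hasDerivAt_id (1 : ℝ)).pow 2).const_sub
      1).div_const (2 * σ ^ 2)).mul_const B |>.const_add (V Q₀ σ d))
    refine h.congr_deriv ?_
    simp
    field_simp
    ring
  have hzero := hlocal.hasDerivAt_eq_zero hderiv
  have hBA : B = σ ^ 2 * V Q₀ σ d := by
    field_simp at hzero
    linarith
  calc _ = ∫ x, (gauss σ x * x ^ 2 * Q₀ (x - d) - σ ^ 2 * (gauss σ x * Q₀ (x - d))) := by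
        congr 1; ext x; ring
    _ = B - σ ^ 2 * V Q₀ σ d := by
        rw [integral_sub hB (hA.const_mul _), integral_const_mul]; rfl
    _ = 0 := sub_eq_zero.2 hBA

/-- `x ^ 2 - σ ^ 2` cannot have constant sign on the support of the shifted function when `σ`
is a maximizer. -/
theorem exists_mul_sq_sub_neg {w : ℝ} {Q₀ : ℝ → ℝ} (hQmeas : Measurable Q₀)
    (hQbdd : ∃ C : ℝ, ∀ x, Q₀ x ≤ C) (hQnonneg : ∀ x, 0 ≤ Q₀ x)
    (hQsupp : ∀ x, x ∉ Set.Icc 0 w → Q₀ x = 0) (hQne : ¬ (Q₀ =ᵐ[volume] 0))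
    {d σ : ℝ} (hσ : 0 < σ) (hmax : ∀ τ : ℝ, 0 < τ → V Q₀ τ d ≤ V Q₀ σ d)
    {c : ℝ} (hc : c ≠ 0) : ∃ x ∈ Set.Icc d (d + w), c * (x ^ 2 - σ ^ 2) < 0 := by
  by_contra! hsign
  have hint := (integrable_mul_comp_sub hQmeas hQbdd hQnonneg hQsupp d
    ((continuous_gauss σ).mul ((continuous_pow 2).sub
      (continuous_const (y := σ ^ 2))))).const_mul c
  have hnonneg : 0 ≤ fun x => c * (gauss σ x * (x ^ 2 - σ ^ 2) * Q₀ (x - d)) := by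
    intro x
    by_cases hx : x - d ∈ Set.Icc 0 w
    · have := hsign x ⟨by linarith [hx.1], by linarith [hx.2]⟩
      calc (0 : ℝ) ≤ gauss σ x * (c * (x ^ 2 - σ ^ 2)) * Q₀ (x - d) :=
            mul_nonneg (mul_nonneg (gauss_pos hσ x).le this) (hQnonneg _)
        _ = _ := by ring
    · simp [hQsupp _ hx]
  have hzero : ∫ x, c * (gauss σ x * (x ^ 2 - σ ^ 2) * Q₀ (x - d)) = 0 := by
    rw [integral_const_mul,
      integral_gauss_mul_sq_sub_eq_zero hQmeas hQbdd hQnonneg hQsupp hσ hmax, mul_zero]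
  have hae := (integral_eq_zero_iff_of_nonneg hnonneg hint).1 hzero
  have hshift : ∀ᵐ x : ℝ, Q₀ (x - d) = 0 := by
    filter_upwards [hae, Measure.ae_ne volume σ, Measure.ae_ne volume (-σ)] with x hx h₁ h₂
    have hsq : x ^ 2 - σ ^ 2 ≠ 0 := fun h => by
      rcases sq_eq_sq_iff_eq_or_eq_neg.1 (sub_eq_zero.1 h) with h | h
      exacts [h₁ h, h₂ h]
    simpa [hc, (gauss_pos hσ x).ne', hsq] using hx
  refine hQne ?_
  filter_upwards [(measurePreserving_add_right volume d).quasiMeasurePreserving.ae hshift]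
    with x hx
  simpa using hx

theorem sigma_increases_with_shift (w : ℝ) (hw : 0 < w) (Q₀ : ℝ → ℝ)
    (hQmeas : Measurable Q₀) (hQbdd : ∃ C : ℝ, ∀ x, Q₀ x ≤ C)
    (hQnonneg : ∀ x, 0 ≤ Q₀ x)
    (hQsupp : ∀ x, x ∉ Set.Icc 0 w → Q₀ x = 0)
    (hQne : ¬ (Q₀ =ᵐ[volume] 0))
    (d₁ d₂ : ℝ) (hd₁ : 0 < d₁) (hd₂ : 0 < d₂) (hdist : d₁ + 2 * w ≤ d₂)
    (σ₁ σ₂ : ℝ) (hσ₁ : 0 < σ₁) (hσ₂ : 0 < σ₂)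
    (hmax₁ : ∀ σ : ℝ, 0 < σ → V Q₀ σ d₁ ≤ V Q₀ σ₁ d₁)
    (hmax₂ : ∀ σ : ℝ, 0 < σ → V Q₀ σ d₂ ≤ V Q₀ σ₂ d₂) :
    σ₁ + w < σ₂ := by
  obtain ⟨x, hx, hx_neg⟩ := exists_mul_sq_sub_neg hQmeas hQbdd hQnonneg hQsupp hQne hσ₁ hmax₁
    (c := -1) (by norm_num)
  obtain ⟨y, hy, hy_neg⟩ := exists_mul_sq_sub_neg hQmeas hQbdd hQnonneg hQsupp hQne hσ₂ hmax₂
    (c := 1) one_ne_zero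
  have h₁ : σ₁ < x := lt_of_pow_lt_pow_left₀ 2 (by linarith [hx.1]) (by linarith)
  have h₂ : y < σ₂ := lt_of_pow_lt_pow_left₀ 2 hσ₂.le (by linarith)
  linarith [hx.2, hy.1]
end

section
/- For every fixed σ > 0, the map d ↦ V(σ, d) is strictly decreasing on (0, ∞): for all 0 < d₁ < d₂, V(σ, d₂) < V(σ, d₁). -/
open Real MeasureTheory

lemma integrable_gauss {σ : ℝ} (hσ : 0 < σ) : Integrable (gauss σ) := by
  have h := (integrable_exp_neg_mul_sq (b := 1 / (2 * σ ^ 2)) (by positivity)).const_mul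
    (1 / (σ * Real.sqrt (2 * Real.pi)))
  refine h.congr (Filter.Eventually.of_forall fun x => ?_)
  simp only [gauss]
  congr 2
  ring

lemma gauss_lt_gauss {σ x y : ℝ} (hσ : 0 < σ) (hx : 0 ≤ x) (hxy : x < y) :
    gauss σ y < gauss σ x := by
  unfold gauss
  gcongr

lemma V_eq_integral_translate (Q₀ : ℝ → ℝ) (σ d : ℝ) :
    V Q₀ σ d = ∫ y, gauss σ (y + d) * Q₀ y := by
  rw [V, ← integral_add_right_eq_self (fun x => gauss σ x * Q₀ (x - d)) d]
  simp

theorem V_strictAnti_in_shift (w : ℝ) (hw : 0 < w) (Q₀ : ℝ → ℝ)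
    (hQmeas : Measurable Q₀) (hQbdd : ∃ C : ℝ, ∀ x, Q₀ x ≤ C)
    (hQnonneg : ∀ x, 0 ≤ Q₀ x)
    (hQsupp : ∀ x, x ∉ Set.Icc 0 w → Q₀ x = 0)
    (hQne : ¬ (Q₀ =ᵐ[volume] 0)) (σ : ℝ) (hσ : 0 < σ) :
    ∀ d₁ d₂ : ℝ, 0 < d₁ → d₁ < d₂ → V Q₀ σ d₂ < V Q₀ σ d₁ := by
  intro d₁ d₂ hd₁ hd
  obtain ⟨C, hC⟩ := hQbdd
  have integrable_translate (d : ℝ) : Integrable fun y => gauss σ (y + d) * Q₀ y :=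
    ((integrable_gauss hσ).comp_add_right d).mul_bdd (c := C) hQmeas.aestronglyMeasurable
      (Filter.Eventually.of_forall fun y => by
        rw [Real.norm_of_nonneg (hQnonneg y)]
        exact hC y)
  have hlt (y : ℝ) (hy : Q₀ y ≠ 0) : gauss σ (y + d₂) * Q₀ y < gauss σ (y + d₁) * Q₀ y := by
    have hmem : y ∈ Set.Icc 0 w := not_imp_comm.1 (hQsupp y) hy
    exact mul_lt_mul_of_pos_right
      (gauss_lt_gauss hσ (add_nonneg hmem.1 hd₁.le) (by linarith))
      ((hQnonneg y).lt_of_ne' hy)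
  have hle (y : ℝ) : gauss σ (y + d₂) * Q₀ y ≤ gauss σ (y + d₁) * Q₀ y := by
    by_cases hy : Q₀ y = 0
    · simp [hy]
    · exact (hlt y hy).le
  rw [V_eq_integral_translate, V_eq_integral_translate]
  refine (integral_mono (integrable_translate d₂) (integrable_translate d₁) hle).lt_of_ne fun heq => hQne ?_
  have hae := (integral_eq_iff_of_ae_le (integrable_translate d₂) (integrable_translate d₁)
    (Filter.Eventually.of_forall hle)).1 heq
  filter_upwards [hae] with y hy
  by_contra h
  exact (hlt y h).ne hy
end
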